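/- Let ψ : ℝ × ℝ → ℂ be the time–radius part of the quadrupole hopfion, ψ(t, r) = r² / (r² − (t − i)²)³, and define η(t, r) = r² · ( r⁸ + (12 t² + 4) r⁶ + ((126/5) t⁴ + 28 t² + 6) r⁴ + (12 t⁶ + 28 t⁴ + 20 t² + 4) r² + (t² + 1)⁴ ) / (((r + t)² + 1)⁵ · ((r − t)² + 1)⁵). Then for all real t and r: (1/6) · ( r² · |∂ψ/∂t (t, r)|² + |∂/∂r ( r · ψ(t, r) )|² ) + (3/4) · |ψ(t, r)|² + (1/24) · ( | ∂/∂r ( r · ∂/∂r ( r · ψ(t, r) ) ) − 3 ψ(t, r) |² + | ∂/∂r ( r² · ∂ψ/∂t (t, r) ) |² ) = (15/4) · r² · η(t, r). -/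

import Mathlib

/-- Time–radius part of the quadrupole hopfion: `ψ(t,r) = r²/(r² − (t−i)²)³`. -/
noncomputable def psiq (t r : ℝ) : ℂ :=
  (r : ℂ) ^ 2 / ((r : ℂ) ^ 2 - ((t : ℂ) - Complex.I) ^ 2) ^ 3

/-- The profile `η(t,r)` of the Bel–Robinson super-energy density of the type N
gravitational quadrupole hopfion. -/
noncomputable def etaq (t r : ℝ) : ℝ :=
  r ^ 2 * (r ^ 8 + (12 * t ^ 2 + 4) * r ^ 6
      + ((126 / 5) * t ^ 4 + 28 * t ^ 2 + 6) * r ^ 4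
      + (12 * t ^ 6 + 28 * t ^ 4 + 20 * t ^ 2 + 4) * r ^ 2 + (t ^ 2 + 1) ^ 4) /
    (((r + t) ^ 2 + 1) ^ 5 * ((r - t) ^ 2 + 1) ^ 5)

theorem qD_ne (t r : ℝ) : ((r : ℂ) ^ 2 - ((t : ℂ) - Complex.I) ^ 2) ≠ 0 := by
  intro h
  have h1 := congrArg Complex.re h
  have h2 := congrArg Complex.im h
  simp [pow_two] at h1 h2
  have ht : t = 0 := by linarith
  subst ht
  nlinarith [sq_nonneg r]

theorem q_dt (t r : ℝ) : deriv (fun s => psiq s r) t =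
    6 * (r : ℂ) ^ 2 * ((t : ℂ) - Complex.I) / ((r : ℂ) ^ 2 - ((t : ℂ) - Complex.I) ^ 2) ^ 4 := by
  have hD := qD_ne t r
  have h0 : HasDerivAt (fun s : ℝ => (s : ℂ)) 1 t := Complex.ofRealCLM.hasDerivAt
  have h1 := (((((h0.sub_const Complex.I).pow 2).const_sub ((r : ℂ) ^ 2)).pow 3)).fun_inv
    (pow_ne_zero 3 hD)
  have h2 := h1.const_mul ((r : ℂ) ^ 2)
  have h3 : (fun s => psiq s r) = fun s : ℝ => (r : ℂ) ^ 2 *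
      (((r : ℂ) ^ 2 - ((s : ℂ) - Complex.I) ^ 2) ^ 3)⁻¹ := by
    funext s; simp [psiq, div_eq_mul_inv]
  rw [h3]
  refine Eq.trans h2.deriv ?_
  simp
  field_simp
  ring

theorem q_dr (t r : ℝ) : deriv (fun s : ℝ => (s : ℂ) * psiq t s) r =
    -3 * (r : ℂ) ^ 2 * ((r : ℂ) ^ 2 + ((t : ℂ) - Complex.I) ^ 2) /
      ((r : ℂ) ^ 2 - ((t : ℂ) - Complex.I) ^ 2) ^ 4 := by
  have hD := qD_ne t r
  have h0 : HasDerivAt (fun s : ℝ => (s : ℂ)) 1 r := Complex.ofRealCLM.hasDerivAt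
  have h2 := (h0.pow 3).div (((h0.pow 2).sub_const (((t : ℂ) - Complex.I) ^ 2)).pow 3)
    (pow_ne_zero 3 hD)
  have h3 : (fun s : ℝ => (s : ℂ) * psiq t s) = fun s : ℝ => (s : ℂ) ^ 3 /
      ((s : ℂ) ^ 2 - ((t : ℂ) - Complex.I) ^ 2) ^ 3 := by
    funext s; simp only [psiq]; ring
  rw [h3]
  refine Eq.trans h2.deriv ?_
  simp
  field_simp
  ring

theorem q_drr (t r : ℝ) :
    deriv (fun s : ℝ => (s : ℂ) * deriv (fun u : ℝ => (u : ℂ) * psiq t u) s) r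
      - 3 * psiq t r =
    6 * (r : ℂ) ^ 2 * ((r : ℂ) ^ 4 + 6 * (r : ℂ) ^ 2 * ((t : ℂ) - Complex.I) ^ 2
      + ((t : ℂ) - Complex.I) ^ 4) /
      ((r : ℂ) ^ 2 - ((t : ℂ) - Complex.I) ^ 2) ^ 5 := by
  have hD := qD_ne t r
  have h0 : HasDerivAt (fun s : ℝ => (s : ℂ)) 1 r := Complex.ofRealCLM.hasDerivAt
  have h2 := (((h0.pow 3).mul ((h0.pow 2).add_const (((t : ℂ) - Complex.I) ^ 2))).const_mul
    (-3 : ℂ)).div (((h0.pow 2).sub_const (((t : ℂ) - Complex.I) ^ 2)).pow 4)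
    (pow_ne_zero 4 hD)
  have h3 : (fun s : ℝ => (s : ℂ) * deriv (fun u : ℝ => (u : ℂ) * psiq t u) s) =
      fun s : ℝ => (-3 * ((s : ℂ) ^ 3 * ((s : ℂ) ^ 2 + ((t : ℂ) - Complex.I) ^ 2))) /
      ((s : ℂ) ^ 2 - ((t : ℂ) - Complex.I) ^ 2) ^ 4 := by
    funext s; rw [q_dr]; ring
  have h4 : deriv (fun s : ℝ => (-3 * ((s : ℂ) ^ 3 * ((s : ℂ) ^ 2 + ((t : ℂ) - Complex.I) ^ 2))) /
      ((s : ℂ) ^ 2 - ((t : ℂ) - Complex.I) ^ 2) ^ 4) r = _ := h2.deriv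
  rw [h3, h4]
  simp [psiq]
  field_simp
  ring

theorem q_drt (t r : ℝ) :
    deriv (fun s : ℝ => (s : ℂ) ^ 2 * deriv (fun u => psiq u s) t) r =
    -24 * (r : ℂ) ^ 3 * ((t : ℂ) - Complex.I) * ((r : ℂ) ^ 2 + ((t : ℂ) - Complex.I) ^ 2) /
      ((r : ℂ) ^ 2 - ((t : ℂ) - Complex.I) ^ 2) ^ 5 := by
  have hD := qD_ne t r
  have h0 : HasDerivAt (fun s : ℝ => (s : ℂ)) 1 r := Complex.ofRealCLM.hasDerivAt
  have h2 := ((h0.pow 4).const_mul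
    (6 * ((t : ℂ) - Complex.I))).div (((h0.pow 2).sub_const (((t : ℂ) - Complex.I) ^ 2)).pow 4)
    (pow_ne_zero 4 hD)
  have h3 : (fun s : ℝ => (s : ℂ) ^ 2 * deriv (fun u => psiq u s) t) =
      fun s : ℝ => (6 * ((t : ℂ) - Complex.I) * (s : ℂ) ^ 4) /
      ((s : ℂ) ^ 2 - ((t : ℂ) - Complex.I) ^ 2) ^ 4 := by
    funext s; rw [q_dt]; ring
  rw [h3]
  refine Eq.trans h2.deriv ?_
  simp
  field_simp
  ring

theorem q_n1 (t : ℝ) : Complex.normSq ((t : ℂ) - Complex.I) = t ^ 2 + 1 := by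
  simp [Complex.normSq_apply]; ring

theorem q_n2 (t r : ℝ) : Complex.normSq ((r : ℂ) ^ 2 + ((t : ℂ) - Complex.I) ^ 2) =
    (r ^ 2 + t ^ 2 - 1) ^ 2 + 4 * t ^ 2 := by
  simp [Complex.normSq_apply, pow_two]; ring

theorem q_n3 (t r : ℝ) : Complex.normSq ((r : ℂ) ^ 2 - ((t : ℂ) - Complex.I) ^ 2) =
    ((r + t) ^ 2 + 1) * ((r - t) ^ 2 + 1) := by
  simp [Complex.normSq_apply, pow_two]; ring

theorem q_n4 (t r : ℝ) : Complex.normSq ((r : ℂ) ^ 4 + 6 * (r : ℂ) ^ 2 * ((t : ℂ) - Complex.I) ^ 2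
      + ((t : ℂ) - Complex.I) ^ 4) =
    (r ^ 4 + 6 * r ^ 2 * (t ^ 2 - 1) + (t ^ 2 - 1) ^ 2 - 4 * t ^ 2) ^ 2
      + (12 * r ^ 2 * t + 4 * t * (t ^ 2 - 1)) ^ 2 := by
  have : (r : ℂ) ^ 4 + 6 * (r : ℂ) ^ 2 * ((t : ℂ) - Complex.I) ^ 2
      + ((t : ℂ) - Complex.I) ^ 4 =
    ((r ^ 4 + 6 * r ^ 2 * (t ^ 2 - 1) + (t ^ 2 - 1) ^ 2 - 4 * t ^ 2 : ℝ) : ℂ)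
      + ((-(12 * r ^ 2 * t + 4 * t * (t ^ 2 - 1)) : ℝ) : ℂ) * Complex.I := by
    push_cast
    linear_combination (6 * (r : ℂ) ^ 2 + 6 * (t : ℂ) ^ 2 - 4 * t * Complex.I
      + Complex.I ^ 2 - 1) * Complex.I_sq
  rw [this, Complex.normSq_add_mul_I]; ring

/-- Time–radius reduction of the Bel–Robinson super-energy density `F₃` of the type N
gravitational quadrupole hopfion:
`(1/6)(r²|∂_t ψ|² + |∂_r(rψ)|²) + (3/4)|ψ|²
  + (1/24)(|∂_r(r ∂_r(rψ)) − 3ψ|² + |∂_r(r² ∂_t ψ)|²) = (15/4) r² η(t,r)`. -/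
theorem quadrupole_superenergy_density_identity (t r : ℝ) :
    (1 / 6) * (r ^ 2 * (norm (deriv (fun s => psiq s r) t)) ^ 2
        + (norm (deriv (fun s : ℝ => (s : ℂ) * psiq t s) r)) ^ 2)
      + (3 / 4) * (norm (psiq t r)) ^ 2
      + (1 / 24) * ((norm
            (deriv (fun s : ℝ => (s : ℂ) * deriv (fun u : ℝ => (u : ℂ) * psiq t u) s) r
              - 3 * psiq t r)) ^ 2
          + (norm
              (deriv (fun s : ℝ => (s : ℂ) ^ 2 * deriv (fun u => psiq u s) t) r)) ^ 2)
      = (15 / 4) * r ^ 2 * etaq t r := by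
  rw [q_drr, q_drt, q_dt, q_dr]
  simp only [psiq, etaq, ← Complex.normSq_eq_norm_sq, map_div₀, map_mul, map_pow, q_n1, q_n2,
    q_n3, q_n4, Complex.normSq_ofReal]
  have e6 : Complex.normSq 6 = 36 := by norm_num [Complex.normSq_apply]
  have e3 : Complex.normSq (-3) = 9 := by norm_num [Complex.normSq_apply]
  have e24 : Complex.normSq (-24) = 576 := by norm_num [Complex.normSq_apply]
  rw [e6, e3, e24, ← mul_pow ((r + t) ^ 2 + 1)]
  have hM : ((r + t) ^ 2 + 1) * ((r - t) ^ 2 + 1) ≠ 0 := by positivity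
  obtain ⟨M, hMd⟩ : ∃ M, M = ((r + t) ^ 2 + 1) * ((r - t) ^ 2 + 1) := ⟨_, rfl⟩
  rw [← hMd] at hM ⊢
  field_simp
  rw [hMd]
  ring
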